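/- arXiv:2005.07139 — 2 statements merged into one kernel-verified Lean document; each statement's English description precedes it below -/
import Mathlib

section
/- Let (a_k)_{k≥1} and (b_k)_{k≥1} be sequences of nonnegative real numbers, each satisfying the V(α,η) coefficient inequality ∑_{k=1}^∞ σ_k [k(1+η) + (1+η(2α−1))] a_k ≤ 2η(1−α) and ∑_{k=1}^∞ σ_k [k(1+η) + (1+η(2α−1))] b_k ≤ 2η(1−α). Let δ be a real number with 0 < δ ≤ 1 such that for every integer k ≥ 1, 2η²(1−α)(k+1) ≤ δ · ( σ_k [k(1+η) + (1+η(2α−1))]² − 2η²(1−α)(k+2α−1) ). Then the coefficient sequence (a_k b_k)_{k≥1} of the Hadamard product (f*g)(z) = 1/z + ∑_{k=1}^∞ a_k b_k z^k satisfies the V(α,δ) coefficient inequality: ∑_{k=1}^∞ σ_k [k(1+δ) + (1+δ(2α−1))] a_k b_k ≤ 2δ(1−α). -/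
/-- If the weighted sequences `σ C a` and `σ C b` have sum at most `η * N` and
`η ^ 2 * N * E ≤ δ * (σ * C ^ 2)` termwise, then `∑ σ E (a b) ≤ δ * N`. -/
theorem summable_and_tsum_hadamard_le {ι : Type*} {σ C E a b : ι → ℝ} {η δ N : ℝ}
    (hη : 0 < η) (hδ : 0 ≤ δ) (hN : 0 < N)
    (hσ : ∀ k, 0 ≤ σ k) (hC : ∀ k, 0 ≤ C k) (hE : ∀ k, 0 ≤ E k)
    (ha : ∀ k, 0 ≤ a k) (hb : ∀ k, 0 ≤ b k)
    (hsa : Summable fun k => σ k * C k * a k) (hta : ∑' k, σ k * C k * a k ≤ η * N)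
    (hsb : Summable fun k => σ k * C k * b k) (htb : ∑' k, σ k * C k * b k ≤ η * N)
    (h : ∀ k, η ^ 2 * N * E k ≤ δ * (σ k * C k ^ 2)) :
    (Summable fun k => σ k * E k * (a k * b k)) ∧
      ∑' k, σ k * E k * (a k * b k) ≤ δ * N := by
  have hxb (k) : σ k * C k * b k ≤ η * N :=
    (hsb.le_tsum k fun j _ => mul_nonneg (mul_nonneg (hσ j) (hC j)) (hb j)).trans htb
  have hterm (k) : σ k * E k * (a k * b k) ≤ δ / η * (σ k * C k * a k) := by
    rw [div_mul_eq_mul_div, le_div_iff₀ hη]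
    refine le_of_mul_le_mul_left ?_ (mul_pos hη hN)
    calc η * N * (σ k * E k * (a k * b k) * η)
        = η ^ 2 * N * E k * (σ k * (a k * b k)) := by ring
      _ ≤ δ * (σ k * C k ^ 2) * (σ k * (a k * b k)) :=
          mul_le_mul_of_nonneg_right (h k) (mul_nonneg (hσ k) (mul_nonneg (ha k) (hb k)))
      _ = σ k * C k * b k * (δ * (σ k * C k * a k)) := by ring
      _ ≤ η * N * (δ * (σ k * C k * a k)) :=
          mul_le_mul_of_nonneg_right (hxb k)
            (mul_nonneg hδ (mul_nonneg (mul_nonneg (hσ k) (hC k)) (ha k)))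
  have hs : Summable fun k => σ k * E k * (a k * b k) :=
    Summable.of_nonneg_of_le
      (fun k => mul_nonneg (mul_nonneg (hσ k) (hE k)) (mul_nonneg (ha k) (hb k)))
      hterm (hsa.mul_left _)
  refine ⟨hs, (hs.tsum_le_tsum hterm (hsa.mul_left _)).trans ?_⟩
  rw [tsum_mul_left]
  calc δ / η * ∑' k, σ k * C k * a k ≤ δ / η * (η * N) :=
        mul_le_mul_of_nonneg_left hta (div_nonneg hδ hη.le)
    _ = δ * N := by field_simp


theorem stmt_7
    (ℓ p : ℕ) (hℓ : 0 < ℓ) (hp : 0 < p)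
    (A : Fin ℓ → ℝ) (B : Fin p → ℝ)
    (hA : ∀ t, 0 < A t) (hB : ∀ t, 0 < B t)
    (σ : ℕ → ℝ)
    (hσ : ∀ k : ℕ, 1 ≤ k →
      σ k = ((∏ t, Real.Gamma (B t)) / (∏ t, Real.Gamma (A t))) *
        ((∏ t, Real.Gamma (A t + k + 1)) /
          ((Nat.factorial (k + 1) : ℝ) * ∏ t, Real.Gamma (B t + k + 1))))
    (α η : ℝ) (hα0 : 0 < α) (hα1 : α < 1) (hη0 : 0 < η) (hη1 : η ≤ 1)
    (a b : ℕ → ℝ) (ha : ∀ k, 1 ≤ k → 0 ≤ a k) (hb : ∀ k, 1 ≤ k → 0 ≤ b k)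
    (hsuma : Summable (fun k : ℕ =>
      σ (k+1) * (((k : ℝ) + 1) * (1 + η) + (1 + η * (2*α - 1))) * (a (k+1))))
    (hcoefa : ∑' k : ℕ,
      σ (k+1) * (((k : ℝ) + 1) * (1 + η) + (1 + η * (2*α - 1))) * (a (k+1))
        ≤ 2 * η * (1 - α))
    (hsumb : Summable (fun k : ℕ =>
      σ (k+1) * (((k : ℝ) + 1) * (1 + η) + (1 + η * (2*α - 1))) * (b (k+1))))
    (hcoefb : ∑' k : ℕ,
      σ (k+1) * (((k : ℝ) + 1) * (1 + η) + (1 + η * (2*α - 1))) * (b (k+1))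
        ≤ 2 * η * (1 - α))
    (δ : ℝ) (hδ0 : 0 < δ) (hδ1 : δ ≤ 1)
    (hδk : ∀ k : ℕ, 1 ≤ k →
      2 * η^2 * (1 - α) * ((k : ℝ) + 1) ≤
        δ * (σ k * ((k : ℝ) * (1 + η) + (1 + η * (2*α - 1)))^2
          - 2 * η^2 * (1 - α) * ((k : ℝ) + 2*α - 1))) :
    Summable (fun k : ℕ =>
      σ (k+1) * (((k : ℝ) + 1) * (1 + δ) + (1 + δ * (2*α - 1))) * (a (k+1) * b (k+1))) ∧
    ∑' k : ℕ,
      σ (k+1) * (((k : ℝ) + 1) * (1 + δ) + (1 + δ * (2*α - 1))) * (a (k+1) * b (k+1))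
        ≤ 2 * δ * (1 - α) := by
  have hσ_nonneg (k : ℕ) : 0 ≤ σ (k + 1) := by
    rw [hσ (k + 1) (Nat.le_add_left 1 k)]
    have hGA (t) : 0 < Real.Gamma (A t) := Real.Gamma_pos_of_pos (hA t)
    have hGB (t) : 0 < Real.Gamma (B t) := Real.Gamma_pos_of_pos (hB t)
    have hGA' (t) : 0 < Real.Gamma (A t + (k + 1 : ℕ) + 1) :=
      Real.Gamma_pos_of_pos (by have := hA t; positivity)
    have hGB' (t) : 0 < Real.Gamma (B t + (k + 1 : ℕ) + 1) :=
      Real.Gamma_pos_of_pos (by have := hB t; positivity)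
    have h₁ := Finset.prod_pos fun t (_ : t ∈ Finset.univ) => hGA t
    have h₂ := Finset.prod_pos fun t (_ : t ∈ Finset.univ) => hGB t
    have h₃ := Finset.prod_pos fun t (_ : t ∈ Finset.univ) => hGA' t
    have h₄ := Finset.prod_pos fun t (_ : t ∈ Finset.univ) => hGB' t
    positivity
  have hcoef_nonneg {ε : ℝ} (hε : 0 < ε) (k : ℕ) :
      0 ≤ ((k : ℝ) + 1) * (1 + ε) + (1 + ε * (2*α - 1)) := by
    have : ((k : ℝ) + 1) * (1 + ε) + (1 + ε * (2*α - 1)) = k + 2 + ε * (k + 2 * α) := by ring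
    rw [this]
    positivity
  rw [show 2 * δ * (1 - α) = δ * (2 * (1 - α)) by ring]
  rw [show 2 * η * (1 - α) = η * (2 * (1 - α)) by ring] at hcoefa hcoefb
  refine summable_and_tsum_hadamard_le hη0 hδ0.le (by linarith) hσ_nonneg
    (hcoef_nonneg hη0) (hcoef_nonneg hδ0) (fun k => ha _ (Nat.le_add_left 1 k))
    (fun k => hb _ (Nat.le_add_left 1 k)) hsuma hcoefa hsumb hcoefb fun k => ?_
  have := hδk (k + 1) (Nat.le_add_left 1 k)
  push_cast at this
  linear_combination this
end

section
/- Let (a_{k,1})_{k≥1} and (a_{k,2})_{k≥1} be sequences of nonnegative real numbers, each satisfying the V(α,η) coefficient inequality ∑_{k=1}^∞ σ_k [k(1+η) + (1+η(2α−1))] a_{k,i} ≤ 2η(1−α) for i = 1, 2. Let β be a real number with 0 < β ≤ 1 such that for every integer k ≥ 1, (k(1+β) + (1+β(2α−1)))/β ≤ σ_k [k(1+η) + (1+η(2α−1))]² / (4η²(1−α)). Then the sequence (a_{k,1}² + a_{k,2}²)_{k≥1}, which is the coefficient sequence of g(z) = 1/z + ∑_{k=1}^∞ (a_{k,1}² +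 a_{k,2}²) z^k, satisfies the V(α,β) coefficient inequality: ∑_{k=1}^∞ σ_k [k(1+β) + (1+β(2α−1))] (a_{k,1}² + a_{k,2}²) ≤ 2β(1−α). -/
/-- The termwise comparison: a weighted square is dominated by a multiple of the weighted term. -/
lemma weighted_sq_le {s v w a α β η : ℝ} (hs : 0 ≤ s) (hα : α < 1) (hβ : 0 < β) (hη : 0 < η)
    (hu₀ : 0 ≤ s * w * a) (hu : s * w * a ≤ 2 * η * (1 - α))
    (h : v / β ≤ s * w ^ 2 / (4 * η ^ 2 * (1 - α))) :
    s * v * a ^ 2 ≤ β / (2 * η) * (s * w * a) := by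
  have hα' : 0 < 1 - α := sub_pos.2 hα
  have hc : 0 < 2 * η * (1 - α) := by positivity
  rw [div_le_div_iff₀ hβ (by positivity)] at h
  have hsq : s * v * a ^ 2 * (4 * η ^ 2 * (1 - α)) ≤ β * (s * w * a) ^ 2 := by
    have := mul_le_mul_of_nonneg_left h (mul_nonneg hs (sq_nonneg a))
    linarith
  have hlin : β * (s * w * a) ^ 2 ≤ β * ((s * w * a) * (2 * η * (1 - α))) := by
    rw [sq]
    gcongr
  have hmul : s * v * a ^ 2 * (2 * η) ≤ β * (s * w * a) := by
    refine le_of_mul_le_mul_right ?_ hc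
    linarith
  rw [div_mul_eq_mul_div, le_div_iff₀ (by positivity)]
  exact hmul

lemma coeff_weight_pos {α β : ℝ} (hα : 0 < α) (hβ₀ : 0 < β) (k : ℕ) :
    0 < ((k : ℝ) + 1) * (1 + β) + (1 + β * (2 * α - 1)) := by
  have hk : 0 ≤ (k : ℝ) * (1 + β) := by positivity
  have hαβ : 0 < α * β := by positivity
  linarith

theorem stmt_8
    (ℓ p : ℕ) (hℓ : 0 < ℓ) (hp : 0 < p)
    (A : Fin ℓ → ℝ) (B : Fin p → ℝ)
    (hA : ∀ t, 0 < A t) (hB : ∀ t, 0 < B t)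
    (σ : ℕ → ℝ)
    (hσ : ∀ k : ℕ, 1 ≤ k →
      σ k = ((∏ t, Real.Gamma (B t)) / (∏ t, Real.Gamma (A t))) *
        ((∏ t, Real.Gamma (A t + k + 1)) /
          ((Nat.factorial (k + 1) : ℝ) * ∏ t, Real.Gamma (B t + k + 1))))
    (α η : ℝ) (hα0 : 0 < α) (hα1 : α < 1) (hη0 : 0 < η) (hη1 : η ≤ 1)
    (a₁ a₂ : ℕ → ℝ) (ha₁ : ∀ k, 1 ≤ k → 0 ≤ a₁ k) (ha₂ : ∀ k, 1 ≤ k → 0 ≤ a₂ k)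
    (hsuma1 : Summable (fun k : ℕ =>
      σ (k+1) * (((k : ℝ) + 1) * (1 + η) + (1 + η * (2*α - 1))) * (a₁ (k+1))))
    (hcoefa1 : ∑' k : ℕ,
      σ (k+1) * (((k : ℝ) + 1) * (1 + η) + (1 + η * (2*α - 1))) * (a₁ (k+1))
        ≤ 2 * η * (1 - α))
    (hsuma2 : Summable (fun k : ℕ =>
      σ (k+1) * (((k : ℝ) + 1) * (1 + η) + (1 + η * (2*α - 1))) * (a₂ (k+1))))
    (hcoefa2 : ∑' k : ℕ,
      σ (k+1) * (((k : ℝ) + 1) * (1 + η) + (1 + η * (2*α - 1))) * (a₂ (k+1))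
        ≤ 2 * η * (1 - α))
    (β : ℝ) (hβ0 : 0 < β) (hβ1 : β ≤ 1)
    (hβk : ∀ k : ℕ, 1 ≤ k →
      ((k : ℝ) * (1 + β) + (1 + β * (2*α - 1))) / β ≤
        σ k * ((k : ℝ) * (1 + η) + (1 + η * (2*α - 1)))^2 / (4 * η^2 * (1 - α))) :
    Summable (fun k : ℕ =>
      σ (k+1) * (((k : ℝ) + 1) * (1 + β) + (1 + β * (2*α - 1))) * ((a₁ (k+1))^2 + (a₂ (k+1))^2)) ∧
    ∑' k : ℕ,
      σ (k+1) * (((k : ℝ) + 1) * (1 + β) + (1 + β * (2*α - 1))) * ((a₁ (k+1))^2 + (a₂ (k+1))^2)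
        ≤ 2 * β * (1 - α) := by
  have hσ_pos (k : ℕ) : 0 < σ (k + 1) := by
    have hΓ {n : ℕ} {C : Fin n → ℝ} (hC : ∀ t, 0 < C t) : 0 < ∏ t, Real.Gamma (C t) :=
      Finset.prod_pos fun t _ => Real.Gamma_pos_of_pos (hC t)
    have hA' := hΓ (C := fun t => A t + ((k + 1 : ℕ) : ℝ) + 1)
      fun t => by have := hA t; positivity
    have hB' := hΓ (C := fun t => B t + ((k + 1 : ℕ) : ℝ) + 1)
      fun t => by have := hB t; positivity
    have hA₀ := hΓ hA
    have hB₀ := hΓ hB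
    rw [hσ (k + 1) (Nat.le_add_left 1 k)]
    positivity
  have hbound (a : ℕ → ℝ) (ha : ∀ k, 1 ≤ k → 0 ≤ a k)
      (hsum : Summable (fun k : ℕ =>
        σ (k+1) * (((k : ℝ) + 1) * (1 + η) + (1 + η * (2*α - 1))) * (a (k+1))))
      (hcoef : ∑' k : ℕ,
        σ (k+1) * (((k : ℝ) + 1) * (1 + η) + (1 + η * (2*α - 1))) * (a (k+1))
          ≤ 2 * η * (1 - α)) (k : ℕ) :
      σ (k+1) * (((k : ℝ) + 1) * (1 + β) + (1 + β * (2*α - 1))) * (a (k+1))^2 ≤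
        β / (2 * η) *
          (σ (k+1) * (((k : ℝ) + 1) * (1 + η) + (1 + η * (2*α - 1))) * (a (k+1))) := by
    have hnonneg (j : ℕ) :
        0 ≤ σ (j+1) * (((j : ℝ) + 1) * (1 + η) + (1 + η * (2*α - 1))) * (a (j+1)) :=
      mul_nonneg (mul_pos (hσ_pos j) (coeff_weight_pos hα0 hη0 j)).le
        (ha (j + 1) (Nat.le_add_left 1 j))
    have hk := hβk (k + 1) (Nat.le_add_left 1 k)
    push_cast at hk
    exact weighted_sq_le (hσ_pos k).le hα1 hβ0 hη0 (hnonneg k)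
      ((hsum.le_tsum k fun j _ => hnonneg j).trans hcoef) hk
  have hsum_bound := (hsuma1.add hsuma2).mul_left (β / (2 * η))
  have hle (k : ℕ) := add_le_add (hbound a₁ ha₁ hsuma1 hcoefa1 k) (hbound a₂ ha₂ hsuma2 hcoefa2 k)
  have hsummable := Summable.of_nonneg_of_le
    (fun k => mul_nonneg (mul_pos (hσ_pos k) (coeff_weight_pos hα0 hβ0 k)).le
      (add_nonneg (sq_nonneg (a₁ (k + 1))) (sq_nonneg (a₂ (k + 1)))))
    (fun k => by simpa only [← mul_add] using hle k)
    (by simpa only [← mul_add] using hsum_bound)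
  refine ⟨hsummable, ?_⟩
  calc
    _ ≤ ∑' k : ℕ, β / (2 * η) *
        (σ (k+1) * (((k : ℝ) + 1) * (1 + η) + (1 + η * (2*α - 1))) * (a₁ (k+1)) +
          σ (k+1) * (((k : ℝ) + 1) * (1 + η) + (1 + η * (2*α - 1))) * (a₂ (k+1))) :=
      hsummable.tsum_le_tsum (fun k => by simpa only [← mul_add] using hle k) hsum_bound
    _ ≤ β / (2 * η) * (2 * η * (1 - α) + 2 * η * (1 - α)) := by
      rw [tsum_mul_left, hsuma1.tsum_add hsuma2]
      gcongr
    _ = 2 * β * (1 - α) := by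
      field_simp
      ring
end
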